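/- arXiv:2003.01080 — 6 statements merged into one kernel-verified Lean document; each statement's English description precedes it below -/
import Mathlib

section
/- Let (g,[·,·],α) be a multiplicative Hom-Lie superalgebra over a field K of characteristic zero, n ≥ 2, and let D be a homogeneous α^k-derivation of g (so D∘α = α∘D and D([x,y]) = [D(x),α^k(y)] + (−1)^{|D||x|}[α^k(x),D(y)] for homogeneous x,y). Then D is an α^k-derivation of the induced n-ary Hom-Nambu superalgebra gₙ = (g,[·,…,·]ₙ,α^{n−1}): D([x₁,…,xₙ]ₙ) = Σ_{i=1}^{n} (−1)^{|D||X|^{i−1}} [α^k(x₁),…,D(xᵢ),…,α^k(xₙ)]ₙ for all homogeneous x₁,…,xₙ, where |X|^{i−1} = |x₁|+⋯+|x_{i−1}|. -/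
namespace NHomSuper

/-- The sign `(-1)^d` associated to a degree `d : ℤ₂`. -/
def sgn (K : Type*) [Field K] (d : ZMod 2) : K := (-1 : K) ^ d.val

variable {K : Type*} [Field K] [CharZero K]
variable {V : Type*} [AddCommGroup V] [Module K V]

/-- Sum of the degrees of the entries strictly before position `i`:  `|X|^{i-1}`. -/
def partSum {n : ℕ} (d : Fin n → ZMod 2) (i : Fin n) : ZMod 2 :=
  ∑ j ∈ Finset.univ.filter (fun j => j < i), d j

/-- Sum of the degrees of the entries strictly after position `j`. -/
def sumAfter {n : ℕ} (d : Fin n → ZMod 2) (j : Fin n) : ZMod 2 :=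
  ∑ k ∈ Finset.univ.filter (fun k => j < k), d k

/-- Sum of the degrees of the entries strictly between positions `i` and `j`. -/
def sumBetween {n : ℕ} (d : Fin n → ZMod 2) (i j : Fin n) : ZMod 2 :=
  ∑ k ∈ Finset.univ.filter (fun k => i < k ∧ k < j), d k

/-- The exponent `γ^X_{ij} = (|x_i|+|x_j|)(|x_{j+1}|+⋯+|x_n|) + |x_i|(|x_{i+1}|+⋯+|x_{j-1}|)`. -/
def gamma {n : ℕ} (d : Fin n → ZMod 2) (i j : Fin n) : ZMod 2 :=
  (d i + d j) * sumAfter d j + d i * sumBetween d i j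

/-- The increasing embedding `Fin (m+1) → Fin (m+3)` omitting the two positions `i < j`. -/
def skip2 {m : ℕ} (i j : Fin (m + 3)) (k : Fin (m + 1)) : Fin (m + 3) :=
  if h1 : (k : ℕ) < (i : ℕ) then ⟨(k : ℕ), lt_trans h1 i.isLt⟩
  else if h2 : (k : ℕ) + 1 < (j : ℕ) then ⟨(k : ℕ) + 1, lt_trans h2 j.isLt⟩
  else ⟨(k : ℕ) + 2, by have hk := k.isLt; omega⟩

/-- A Hom-Lie superalgebra structure on the ℤ₂-graded vector space `V` with grading `gr`. -/
structure IsHomLieSuper (gr : ZMod 2 → Submodule K V)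
    (br : V →ₗ[K] V →ₗ[K] V) (α : Module.End K V) : Prop where
  internal : DirectSum.IsInternal gr
  alpha_even : ∀ (a : ZMod 2) (x : V), x ∈ gr a → α x ∈ gr a
  br_even : ∀ (a b : ZMod 2) (x y : V), x ∈ gr a → y ∈ gr b → br x y ∈ gr (a + b)
  skew : ∀ (a b : ZMod 2) (x y : V), x ∈ gr a → y ∈ gr b →
    br x y = - sgn K (a * b) • br y x
  jacobi : ∀ (a b c : ZMod 2) (x y z : V), x ∈ gr a → y ∈ gr b → z ∈ gr c →
    sgn K (a * c) • br (α x) (br y z) + sgn K (b * a) • br (α y) (br z x)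
      + sgn K (c * b) • br (α z) (br x y) = 0

/-- An even multilinear form: it vanishes on homogeneous tuples of nonzero total degree. -/
def FormEven (gr : ZMod 2 → Submodule K V) {p : ℕ}
    (φ : MultilinearMap K (fun _ : Fin p => V) K) : Prop :=
  ∀ (d : Fin p → ZMod 2) (x : Fin p → V), (∀ i, x i ∈ gr (d i)) →
    (∑ i, d i) ≠ 0 → φ x = 0

/-- A super-skew-symmetric multilinear form (adjacent transpositions). -/
def FormSuperSkew (gr : ZMod 2 → Submodule K V) {p : ℕ}
    (φ : MultilinearMap K (fun _ : Fin p => V) K) : Prop :=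
  ∀ (d : Fin p → ZMod 2) (x : Fin p → V), (∀ i, x i ∈ gr (d i)) →
    ∀ i j : Fin p, (j : ℕ) = (i : ℕ) + 1 →
      φ x = - sgn K (d i * d j) * φ (x ∘ Equiv.swap i j)

/-- The `n`-ary product `[x₁,…,xₙ]_φ` (here `n = m+3`) induced by a binary bracket `br`
and an `(n-2)`-cochain `φ`, for a homogeneous tuple `x` with degrees `d`. -/
def phiBr {m : ℕ} (br : V →ₗ[K] V →ₗ[K] V)
    (φ : MultilinearMap K (fun _ : Fin (m + 1) => V) K)
    (d : Fin (m + 3) → ZMod 2) (x : Fin (m + 3) → V) : V :=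
  ∑ p ∈ Finset.univ.filter (fun p : Fin (m + 3) × Fin (m + 3) => p.1 < p.2),
    ((-1 : K) ^ ((p.1 : ℕ) + (p.2 : ℕ) + 1) * sgn K (gamma d p.1 p.2)
      * φ (x ∘ skip2 p.1 p.2)) • br (x p.1) (x p.2)

/-- Condition `φ ∧ δφ_X = 0` of Theorem 2.9. -/
def PhiCond1 {m : ℕ} (gr : ZMod 2 → Submodule K V) (br : V →ₗ[K] V →ₗ[K] V)
    (φ : MultilinearMap K (fun _ : Fin (m + 1) => V) K) : Prop :=
  ∀ (dx : Fin m → ZMod 2) (x : Fin m → V) (dy : Fin (m + 3) → ZMod 2)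
      (y : Fin (m + 3) → V),
    (∀ i, x i ∈ gr (dx i)) → (∀ i, y i ∈ gr (dy i)) →
    ∑ p ∈ Finset.univ.filter (fun p : Fin (m + 3) × Fin (m + 3) => p.1 < p.2),
      (-1 : K) ^ ((p.1 : ℕ) + (p.2 : ℕ)) * sgn K (gamma dy p.1 p.2)
        * φ (y ∘ skip2 p.1 p.2) * φ (Fin.snoc x (br (y p.1) (y p.2))) = 0

/-- Condition `φ ∘ (α ⊗ Id ⊗ ⋯ ⊗ Id) = φ`. -/
def PhiCond2 {m : ℕ} (φ : MultilinearMap K (fun _ : Fin (m + 1) => V) K)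
    (α : Module.End K V) : Prop :=
  ∀ x : Fin (m + 1) → V, φ (Function.update x 0 (α (x 0))) = φ x

/-- A multiplicative `n`-Hom-Lie superalgebra structure (`n = m+3`) given by a
degree-parametrized `n`-linear bracket `B` on homogeneous tuples. -/
structure IsMultNHomLieSuperGr {m : ℕ} (gr : ZMod 2 → Submodule K V)
    (B : (Fin (m + 3) → ZMod 2) → (Fin (m + 3) → V) → V) (α : Module.End K V) : Prop where
  internal : DirectSum.IsInternal gr
  alpha_even : ∀ (a : ZMod 2) (x : V), x ∈ gr a → α x ∈ gr a
  map_add : ∀ (d : Fin (m + 3) → ZMod 2) (x : Fin (m + 3) → V) (i : Fin (m + 3)) (u v : V),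
    B d (Function.update x i (u + v)) = B d (Function.update x i u) + B d (Function.update x i v)
  map_smul : ∀ (d : Fin (m + 3) → ZMod 2) (x : Fin (m + 3) → V) (i : Fin (m + 3)) (c : K) (u : V),
    B d (Function.update x i (c • u)) = c • B d (Function.update x i u)
  even : ∀ (d : Fin (m + 3) → ZMod 2) (x : Fin (m + 3) → V), (∀ i, x i ∈ gr (d i)) →
    B d x ∈ gr (∑ i, d i)
  skew : ∀ (d : Fin (m + 3) → ZMod 2) (x : Fin (m + 3) → V), (∀ i, x i ∈ gr (d i)) →
    ∀ i j : Fin (m + 3), (j : ℕ) = (i : ℕ) + 1 →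
      B d x = - sgn K (d i * d j) • B (d ∘ Equiv.swap i j) (x ∘ Equiv.swap i j)
  mult : ∀ (d : Fin (m + 3) → ZMod 2) (x : Fin (m + 3) → V), (∀ i, x i ∈ gr (d i)) →
    α (B d x) = B d (fun i => α (x i))
  nambu : ∀ (dx : Fin (m + 2) → ZMod 2) (x : Fin (m + 2) → V)
      (dy : Fin (m + 3) → ZMod 2) (y : Fin (m + 3) → V),
      (∀ i, x i ∈ gr (dx i)) → (∀ i, y i ∈ gr (dy i)) →
    B (Fin.snoc dx (∑ i, dy i)) (Fin.snoc (fun i => α (x i)) (B dy y)) =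
      ∑ i : Fin (m + 3), sgn K ((∑ k, dx k) * partSum dy i) •
        B (Function.update dy i ((∑ k, dx k) + dy i))
          (Function.update (fun j => α (y j)) i (B (Fin.snoc dx (dy i)) (Fin.snoc x (y i))))

/-- An `n`-ary Hom-Nambu superalgebra structure (`n = p+2`) with (degree-free) bracket `nbr`. -/
structure IsNaryHomNambuSuper {p : ℕ} (gr : ZMod 2 → Submodule K V)
    (nbr : (Fin (p + 2) → V) → V) (β : Module.End K V) : Prop where
  internal : DirectSum.IsInternal gr
  alpha_even : ∀ (a : ZMod 2) (x : V), x ∈ gr a → β x ∈ gr a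
  map_add : ∀ (x : Fin (p + 2) → V) (i : Fin (p + 2)) (u v : V),
    nbr (Function.update x i (u + v)) = nbr (Function.update x i u) + nbr (Function.update x i v)
  map_smul : ∀ (x : Fin (p + 2) → V) (i : Fin (p + 2)) (c : K) (u : V),
    nbr (Function.update x i (c • u)) = c • nbr (Function.update x i u)
  even : ∀ (d : Fin (p + 2) → ZMod 2) (x : Fin (p + 2) → V), (∀ i, x i ∈ gr (d i)) →
    nbr x ∈ gr (∑ i, d i)
  nambu : ∀ (dx : Fin (p + 1) → ZMod 2) (x : Fin (p + 1) → V)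
      (dy : Fin (p + 2) → ZMod 2) (y : Fin (p + 2) → V),
      (∀ i, x i ∈ gr (dx i)) → (∀ i, y i ∈ gr (dy i)) →
    nbr (Fin.snoc (fun i => β (x i)) (nbr y)) =
      ∑ i : Fin (p + 2), sgn K ((∑ k, dx k) * partSum dy i) •
        nbr (Function.update (fun j => β (y j)) i (nbr (Fin.snoc x (y i))))

/-- A multiplicative `n`-ary Hom-Nambu superalgebra (`n = p+2`). -/
structure IsMultNaryHomNambuSuper {p : ℕ} (gr : ZMod 2 → Submodule K V)
    (nbr : (Fin (p + 2) → V) → V) (β : Module.End K V)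
    extends IsNaryHomNambuSuper gr nbr β : Prop where
  mult : ∀ x : Fin (p + 2) → V, β (nbr x) = nbr fun i => β (x i)

/-- The `n`-ary bracket (`n = p+2`) induced by a binary Hom-Lie superalgebra bracket:
`[x₁,…,xₙ]ₙ = [[…[[x₁,x₂],α(x₃)],…],α^{n-2}(xₙ)]`. -/
def nBr (br : V →ₗ[K] V →ₗ[K] V) (α : Module.End K V) : (p : ℕ) → (Fin (p + 2) → V) → V
  | 0, x => br (x 0) (x 1)
  | p + 1, x => br (nBr br α p (Fin.init x)) ((α ^ (p + 1)) (x (Fin.last (p + 2))))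

/-- A homogeneous `α^k`-derivation of degree `dD` of a binary Hom-superalgebra. -/
def IsAlphaKDeriv2 (gr : ZMod 2 → Submodule K V) (br : V →ₗ[K] V →ₗ[K] V)
    (α : Module.End K V) (k : ℕ) (dD : ZMod 2) (D : Module.End K V) : Prop :=
  D * α = α * D ∧ (∀ (a : ZMod 2) (x : V), x ∈ gr a → D x ∈ gr (a + dD)) ∧
  ∀ (a b : ZMod 2) (x y : V), x ∈ gr a → y ∈ gr b →
    D (br x y) = br (D x) ((α ^ k) y) + sgn K (dD * a) • br ((α ^ k) x) (D y)

/-- A homogeneous `α^k`-derivation of degree `dD` of an `n`-ary Hom-superalgebra (`n = p+2`). -/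
def IsNaryAlphaKDeriv {p : ℕ} (gr : ZMod 2 → Submodule K V)
    (nbr : (Fin (p + 2) → V) → V) (α : Module.End K V) (k : ℕ) (dD : ZMod 2)
    (D : Module.End K V) : Prop :=
  D * α = α * D ∧ (∀ (a : ZMod 2) (x : V), x ∈ gr a → D x ∈ gr (a + dD)) ∧
  ∀ (dy : Fin (p + 2) → ZMod 2) (y : Fin (p + 2) → V), (∀ i, y i ∈ gr (dy i)) →
    D (nbr y) = ∑ i : Fin (p + 2), sgn K (dD * partSum dy i) •
      nbr (Function.update (fun j => (α ^ k) (y j)) i (D (y i)))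

/-- Rota-Baxter operator of weight `0` on a binary Hom-superalgebra. -/
def IsRotaBaxter2 (gr : ZMod 2 → Submodule K V) (br : V →ₗ[K] V →ₗ[K] V)
    (α : Module.End K V) (R : Module.End K V) : Prop :=
  (∀ (a : ZMod 2) (x : V), x ∈ gr a → R x ∈ gr a) ∧ R * α = α * R ∧
  ∀ x y : V, br (R x) (R y) = R (br (R x) y + br x (R y))

/-- The `3`-supercommutator of a ternary product, on homogeneous elements of degrees `a,b,c`. -/
def cbr (T : V → V → V → V) (a b c : ZMod 2) (x y z : V) : V :=
  T x y z + sgn K (a * (b + c)) • T y z x + sgn K (c * (a + b)) • T z x y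

/-- A `3`-Hom-Lie superalgebra structure. -/
structure Is3HomLieSuper (gr : ZMod 2 → Submodule K V)
    (br : V →ₗ[K] V →ₗ[K] V →ₗ[K] V) (α : Module.End K V) : Prop where
  internal : DirectSum.IsInternal gr
  alpha_even : ∀ (a : ZMod 2) (x : V), x ∈ gr a → α x ∈ gr a
  even : ∀ (a b c : ZMod 2) (x y z : V), x ∈ gr a → y ∈ gr b → z ∈ gr c →
    br x y z ∈ gr (a + b + c)
  skew12 : ∀ (a b c : ZMod 2) (x y z : V), x ∈ gr a → y ∈ gr b → z ∈ gr c →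
    br x y z = - sgn K (a * b) • br y x z
  skew23 : ∀ (a b c : ZMod 2) (x y z : V), x ∈ gr a → y ∈ gr b → z ∈ gr c →
    br x y z = - sgn K (b * c) • br x z y
  nambu : ∀ (a₁ a₂ b₁ b₂ b₃ : ZMod 2) (x₁ x₂ y₁ y₂ y₃ : V),
    x₁ ∈ gr a₁ → x₂ ∈ gr a₂ → y₁ ∈ gr b₁ → y₂ ∈ gr b₂ → y₃ ∈ gr b₃ →
    br (α x₁) (α x₂) (br y₁ y₂ y₃) =
      br (br x₁ x₂ y₁) (α y₂) (α y₃)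
      + sgn K ((a₁ + a₂) * b₁) • br (α y₁) (br x₁ x₂ y₂) (α y₃)
      + sgn K ((a₁ + a₂) * (b₁ + b₂)) • br (α y₁) (α y₂) (br x₁ x₂ y₃)

/-- A `3`-Hom-pre-Lie superalgebra structure. -/
structure Is3HomPreLieSuper (gr : ZMod 2 → Submodule K V)
    (T : V →ₗ[K] V →ₗ[K] V →ₗ[K] V) (α : Module.End K V) : Prop where
  internal : DirectSum.IsInternal gr
  alpha_even : ∀ (a : ZMod 2) (x : V), x ∈ gr a → α x ∈ gr a
  even : ∀ (a b c : ZMod 2) (x y z : V), x ∈ gr a → y ∈ gr b → z ∈ gr c →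
    T x y z ∈ gr (a + b + c)
  skew12 : ∀ (a b c : ZMod 2) (x y z : V), x ∈ gr a → y ∈ gr b → z ∈ gr c →
    T x y z = - sgn K (a * b) • T y x z
  ax2 : ∀ (a₁ a₂ a₃ a₄ a₅ : ZMod 2) (x₁ x₂ x₃ x₄ x₅ : V),
    x₁ ∈ gr a₁ → x₂ ∈ gr a₂ → x₃ ∈ gr a₃ → x₄ ∈ gr a₄ → x₅ ∈ gr a₅ →
    T (α x₁) (α x₂) (T x₃ x₄ x₅) =
      T (cbr (K := K) (fun u v w => T u v w) a₁ a₂ a₃ x₁ x₂ x₃) (α x₄) (α x₅)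
      + sgn K (a₃ * (a₁ + a₂)) •
          T (α x₃) (cbr (K := K) (fun u v w => T u v w) a₁ a₂ a₄ x₁ x₂ x₄) (α x₅)
      + sgn K ((a₁ + a₂) * (a₃ + a₄)) • T (α x₃) (α x₄) (T x₁ x₂ x₅)
  ax3 : ∀ (a₁ a₂ a₃ a₄ a₅ : ZMod 2) (x₁ x₂ x₃ x₄ x₅ : V),
    x₁ ∈ gr a₁ → x₂ ∈ gr a₂ → x₃ ∈ gr a₃ → x₄ ∈ gr a₄ → x₅ ∈ gr a₅ →
    T (cbr (K := K) (fun u v w => T u v w) a₁ a₂ a₃ x₁ x₂ x₃) (α x₄) (α x₅) =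
      T (α x₁) (α x₂) (T x₃ x₄ x₅)
      + sgn K (a₁ * (a₂ + a₃)) • T (α x₂) (α x₃) (T x₁ x₄ x₅)
      + sgn K (a₃ * (a₁ + a₂)) • T (α x₃) (α x₁) (T x₂ x₄ x₅)

/-- Rota-Baxter operator of weight `0` on a `3`-Hom-Lie superalgebra. -/
def IsRotaBaxter3 (gr : ZMod 2 → Submodule K V)
    (br : V →ₗ[K] V →ₗ[K] V →ₗ[K] V) (α : Module.End K V) (R : Module.End K V) : Prop :=
  (∀ (a : ZMod 2) (x : V), x ∈ gr a → R x ∈ gr a) ∧ R * α = α * R ∧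
  ∀ x y z : V, br (R x) (R y) (R z) =
    R (br (R x) (R y) z + br (R x) y (R z) + br x (R y) (R z))

lemma partSum_castSucc {n : ℕ} (d : Fin (n + 1) → ZMod 2) (i : Fin n) :
    partSum d i.castSucc = partSum (Fin.init d) i := by
  simp [partSum, Finset.sum_filter, Fin.sum_univ_castSucc, Fin.init,
    (Fin.le_last i.castSucc).not_gt]

lemma partSum_last {n : ℕ} (d : Fin (n + 1) → ZMod 2) :
    partSum d (Fin.last n) = ∑ i, Fin.init d i := by
  simp [partSum, Finset.sum_filter, Fin.sum_univ_castSucc, Fin.init, Fin.castSucc_lt_last]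

omit [CharZero K] in
lemma pow_apply_mem {gr : ZMod 2 → Submodule K V} {α : Module.End K V}
    (hα : ∀ (a : ZMod 2) (x : V), x ∈ gr a → α x ∈ gr a) (m : ℕ) {a : ZMod 2} {x : V}
    (hx : x ∈ gr a) : (α ^ m) x ∈ gr a := by
  induction m with
  | zero => simpa using hx
  | succ m ih => simpa only [pow_succ', Module.End.mul_apply] using hα a _ ih

omit [CharZero K] in
lemma pow_apply_br {br : V →ₗ[K] V →ₗ[K] V} {α : Module.End K V}
    (hmult : ∀ u v : V, α (br u v) = br (α u) (α v)) (m : ℕ) (u v : V) :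
    (α ^ m) (br u v) = br ((α ^ m) u) ((α ^ m) v) := by
  induction m with
  | zero => simp
  | succ m ih => simp only [pow_succ', Module.End.mul_apply, ih, hmult]

omit [CharZero K] in
lemma pow_apply_nBr {br : V →ₗ[K] V →ₗ[K] V} {α : Module.End K V}
    (hmult : ∀ u v : V, α (br u v) = br (α u) (α v)) (m p : ℕ) (x : Fin (p + 2) → V) :
    (α ^ m) (nBr br α p x) = nBr br α p (fun i => (α ^ m) (x i)) := by
  induction p with
  | zero => simp only [nBr, pow_apply_br hmult]
  | succ p ih =>
    have hαα (v : V) : (α ^ m) ((α ^ (p + 1)) v) = (α ^ (p + 1)) ((α ^ m) v) :=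
      LinearMap.congr_fun (Commute.pow_pow_self α m (p + 1)).eq v
    simp only [nBr, pow_apply_br hmult, ih, hαα]
    rfl

omit [CharZero K] in
lemma nBr_mem {gr : ZMod 2 → Submodule K V} {br : V →ₗ[K] V →ₗ[K] V} {α : Module.End K V}
    (hg : IsHomLieSuper gr br α) (p : ℕ) (d : Fin (p + 2) → ZMod 2) (x : Fin (p + 2) → V)
    (hx : ∀ i, x i ∈ gr (d i)) : nBr br α p x ∈ gr (∑ i, d i) := by
  induction p with
  | zero =>
    rw [Fin.sum_univ_two]
    exact hg.br_even _ _ _ _ (hx 0) (hx 1)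
  | succ p ih =>
    rw [Fin.sum_univ_castSucc]
    exact hg.br_even _ _ _ _ (ih (Fin.init d) (Fin.init x) fun i => hx i.castSucc)
      (pow_apply_mem hg.alpha_even _ (hx _))

omit [CharZero K] in
lemma nBr_succ_update_castSucc (br : V →ₗ[K] V →ₗ[K] V) (α : Module.End K V) (p : ℕ)
    (x : Fin (p + 3) → V) (i : Fin (p + 2)) (v : V) :
    nBr br α (p + 1) (Function.update x i.castSucc v) =
      br (nBr br α p (Function.update (Fin.init x) i v))
        ((α ^ (p + 1)) (x (Fin.last (p + 2)))) := by
  rw [nBr, Fin.init_update_castSucc, Function.update_of_ne (Fin.castSucc_lt_last i).ne']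

omit [CharZero K] in
lemma nBr_succ_update_last (br : V →ₗ[K] V →ₗ[K] V) (α : Module.End K V) (p : ℕ)
    (x : Fin (p + 3) → V) (v : V) :
    nBr br α (p + 1) (Function.update x (Fin.last (p + 2)) v) =
      br (nBr br α p (Fin.init x)) ((α ^ (p + 1)) v) := by
  rw [nBr, Fin.init_update_last, Function.update_self]

theorem stmt9 (p k : ℕ) (gr : ZMod 2 → Submodule K V) (br : V →ₗ[K] V →ₗ[K] V)
    (α : Module.End K V) (hg : IsHomLieSuper gr br α)
    (hmult : ∀ u v : V, α (br u v) = br (α u) (α v))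
    (dD : ZMod 2) (D : Module.End K V) (hD : IsAlphaKDeriv2 gr br α k dD D) :
    ∀ (d : Fin (p + 2) → ZMod 2) (x : Fin (p + 2) → V), (∀ i, x i ∈ gr (d i)) →
      D (nBr br α p x) = ∑ i : Fin (p + 2), sgn K (dD * partSum d i) •
        nBr br α p (Function.update (fun j => (α ^ k) (x j)) i (D (x i))) := by
  obtain ⟨hcomm, -, hleib⟩ := hD
  intro d x hx
  induction p with
  | zero =>
    simp [nBr, partSum, Finset.sum_filter, sgn, hleib _ _ _ _ (hx 0) (hx 1)]
  | succ p ih =>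
    have hDα (m : ℕ) (v : V) : D ((α ^ m) v) = (α ^ m) (D v) :=
      LinearMap.congr_fun ((show Commute D α from hcomm).pow_right m).eq v
    have hαα (v : V) : (α ^ k) ((α ^ (p + 1)) v) = (α ^ (p + 1)) ((α ^ k) v) :=
      LinearMap.congr_fun (Commute.pow_pow_self α k (p + 1)).eq v
    have hinit (i : Fin (p + 2)) : Fin.init x i ∈ gr (Fin.init d i) := hx i.castSucc
    rw [Fin.sum_univ_castSucc, nBr,
      hleib _ _ _ _ (nBr_mem hg p _ _ hinit)
        (pow_apply_mem hg.alpha_even _ (hx (Fin.last (p + 2)))),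
      ih _ _ hinit, hDα, hαα, pow_apply_nBr hmult, partSum_last, nBr_succ_update_last]
    simp only [nBr_succ_update_castSucc, partSum_castSucc, map_sum, map_smul,
      LinearMap.sum_apply, LinearMap.smul_apply]
    rfl

end NHomSuper
end

section
/- Let (N,[·,…,·],α) be an n-ary Hom-Nambu superalgebra over a field K of characteristic zero and let R : N → N be an invertible even linear map. Then R is a Rota-Baxter operator of weight 0 on N (i.e. R∘α = α∘R and [R(x₁),…,R(xₙ)] = R(Σ_{i=1}^{n} [R(x₁),…,R(x_{i−1}),xᵢ,R(x_{i+1}),…,R(xₙ)]) for all x₁,…,xₙ) if and only if R⁻¹ is an even derivation of N, i.e. R⁻¹∘α = α∘R⁻¹ and R⁻¹([X₁,…,Xₙ]) = Σ_{i=1}^{n} [X₁,…,R⁻¹(Xᵢ),…,Xₙ] for all X₁,…,Xₙ. -/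
namespace NHomSuper

variable {K : Type*} [Field K] [CharZero K]
variable {V : Type*} [AddCommGroup V] [Module K V]

theorem _root_.LinearMap.map_decompose_of_mapsTo {ι R M : Type*} [DecidableEq ι] [Semiring R]
    [AddCommMonoid M] [Module R M] (ℳ : ι → Submodule R M) [DirectSum.Decomposition ℳ]
    (f : M →ₗ[R] M) (hf : ∀ i, ∀ x ∈ ℳ i, f x ∈ ℳ i) (i : ι) (x : M) :
    f (DirectSum.decompose ℳ x i) = DirectSum.decompose ℳ (f x) i := by
  induction x using DirectSum.Decomposition.inductionOn ℳ with
  | zero => simp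
  | @homogeneous j m =>
    by_cases h : j = i
    · subst h
      rw [DirectSum.decompose_of_mem_same ℳ m.2,
        DirectSum.decompose_of_mem_same ℳ (hf _ _ m.2)]
    · rw [DirectSum.decompose_of_mem_ne ℳ m.2 h,
        DirectSum.decompose_of_mem_ne ℳ (hf _ _ m.2) h, map_zero]
  | add x y hx hy => simp [DirectSum.decompose_add, hx, hy]

theorem _root_.DirectSum.IsInternal.mem_of_mul_eq_one {ι R M : Type*} [DecidableEq ι] [Ring R]
    [AddCommGroup M] [Module R M] {ℳ : ι → Submodule R M} (hℳ : DirectSum.IsInternal ℳ)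
    {f g : Module.End R M} (hfg : f * g = 1) (hgf : g * f = 1)
    (hf : ∀ i, ∀ x ∈ ℳ i, f x ∈ ℳ i) {i : ι} {x : M} (hx : x ∈ ℳ i) : g x ∈ ℳ i := by
  let := hℳ.chooseDecomposition
  have hfg' : f (g x) = x := LinearMap.congr_fun hfg x
  have hgf' : ∀ y, g (f y) = y := LinearMap.congr_fun hgf
  have key : f (DirectSum.decompose ℳ (g x) i) = x := by
    rw [f.map_decompose_of_mapsTo ℳ hf, hfg', DirectSum.decompose_of_mem_same ℳ hx]
  have : g x = DirectSum.decompose ℳ (g x) i := by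
    conv_lhs => rw [← key, hgf']
  rw [this]
  exact SetLike.coe_mem _

theorem stmt11 (p : ℕ) (gr : ZMod 2 → Submodule K V)
    (nbr : (Fin (p + 2) → V) → V) (α : Module.End K V)
    (hN : IsNaryHomNambuSuper gr nbr α)
    (R S : Module.End K V) (hRS : R * S = 1) (hSR : S * R = 1)
    (hReven : ∀ (a : ZMod 2) (x : V), x ∈ gr a → R x ∈ gr a) :
    (R * α = α * R ∧
      ∀ x : Fin (p + 2) → V,
        nbr (fun i => R (x i)) =
          R (∑ i : Fin (p + 2), nbr (Function.update (fun j => R (x j)) i (x i)))) ↔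
    (S * α = α * S ∧ (∀ (a : ZMod 2) (x : V), x ∈ gr a → S x ∈ gr a) ∧
      ∀ X : Fin (p + 2) → V,
        S (nbr X) = ∑ i : Fin (p + 2), nbr (Function.update X i (S (X i)))) := by
  have hR : ∀ v, R (S v) = v := LinearMap.congr_fun hRS
  have hS : ∀ v, S (R v) = v := LinearMap.congr_fun hSR
  constructor
  · rintro ⟨hcomm, hRB⟩
    refine ⟨?_, fun a x hx => hN.internal.mem_of_mul_eq_one hRS hSR hReven hx, fun X => ?_⟩
    · calc S * α = S * (α * R) * S := by rw [mul_assoc, mul_assoc, hRS, mul_one]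
        _ = α * S := by rw [← hcomm, ← mul_assoc, hSR, one_mul]
    · simpa only [hR, hS] using congrArg S (hRB fun i => S (X i))
  · rintro ⟨hcomm, -, hder⟩
    refine ⟨?_, fun x => ?_⟩
    · calc R * α = R * (α * S) * R := by rw [mul_assoc, mul_assoc, hSR, mul_one]
        _ = α * R := by rw [← hcomm, ← mul_assoc, hRS, one_mul]
    · simpa only [hR, hS] using congrArg R (hder fun i => R (x i))

end NHomSuper
end

section
/- Let (g,[·,·],α) be a multiplicative Hom-Lie superalgebra over a field K of characteristic zero, n ≥ 3, let φ be an even super-skew-symmetric (n−2)-linear form on g satisfying the two conditions making (g,[·,…,·]_φ,α) a multiplicative n-Hom-Lie superalgebra, and let R be a Rota-Baxter operator of weight 0 on the Hom-Lie superalgebra g (R even, R∘α = α∘R, [R(x),R(y)] = R([R(x),y] + [x,R(y)])). Then R is a Rota-Baxter operator of weight 0 on the n-Hom-Lie superalgebra (g,[·,…,·]_φ,α) if and only if for all homogeneous x₁,…,xₙ the element Σ_{i=1}^{n} Σ_{k<l, k,l≠i} (−1)^{k+l+1} (−1)^{γ^X_{kl}} φ(R(x₁),…,R(x_k)^,…,xᵢ,…,R(x_l)^,…,R(xₙ))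 [R(x_k),R(x_l)] lies in the kernel of R (here in the φ-argument list the k-th and l-th entries are omitted, the i-th entry is xᵢ, and all other entries xⱼ appear as R(xⱼ)). -/
namespace NHomSuper

variable {K : Type*} [Field K] [CharZero K]
variable {V : Type*} [AddCommGroup V] [Module K V]

theorem skip2_ne {m : ℕ} {i j : Fin (m + 3)} (hij : i < j) (k : Fin (m + 1)) :
    skip2 i j k ≠ i ∧ skip2 i j k ≠ j := by
  have hij' : (i : ℕ) < j := hij
  unfold skip2
  constructor <;> split_ifs <;> intro h <;> have := congrArg Fin.val h <;> simp at this <;> omega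

theorem update_comp_skip2 {m : ℕ} {W : Type*} {p q i : Fin (m + 3)} (hpq : p < q)
    (hi : i = p ∨ i = q) (y : Fin (m + 3) → W) (v : W) :
    Function.update y i v ∘ skip2 p q = y ∘ skip2 p q := by
  funext k
  obtain ⟨h1, h2⟩ := skip2_ne hpq k
  rcases hi with rfl | rfl <;> simp [Function.update_of_ne, h1, h2]

/-- Summing `[R x₁,…,xᵢ,…,R xₙ]_φ` over `i` and splitting each term according to whether `xᵢ`
enters the binary bracket or the form `φ`. -/
theorem sum_phiBr_update {m : ℕ} (br : V →ₗ[K] V →ₗ[K] V)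
    (φ : MultilinearMap K (fun _ : Fin (m + 1) => V) K) (R : Module.End K V)
    (d : Fin (m + 3) → ZMod 2) (x : Fin (m + 3) → V) :
    ∑ i : Fin (m + 3), phiBr br φ d (Function.update (fun j => R (x j)) i (x i)) =
      (∑ i : Fin (m + 3), ∑ q ∈ Finset.univ.filter
            (fun q : Fin (m + 3) × Fin (m + 3) => q.1 < q.2 ∧ q.1 ≠ i ∧ q.2 ≠ i),
          ((-1 : K) ^ ((q.1 : ℕ) + (q.2 : ℕ) + 1) * sgn K (gamma d q.1 q.2)
            * φ ((fun j => if j = i then x j else R (x j)) ∘ skip2 q.1 q.2)) •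
          br (R (x q.1)) (R (x q.2))) +
      ∑ p ∈ Finset.univ.filter (fun p : Fin (m + 3) × Fin (m + 3) => p.1 < p.2),
        ((-1 : K) ^ ((p.1 : ℕ) + (p.2 : ℕ) + 1) * sgn K (gamma d p.1 p.2)
          * φ ((fun j => R (x j)) ∘ skip2 p.1 p.2)) •
        (br (R (x p.1)) (x p.2) + br (x p.1) (R (x p.2))) := by
  set c : Fin (m + 3) × Fin (m + 3) → K := fun p =>
    (-1 : K) ^ ((p.1 : ℕ) + (p.2 : ℕ) + 1) * sgn K (gamma d p.1 p.2) with hc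
  set y : Fin (m + 3) → V := fun j => R (x j) with hy
  have hsplit : ∀ p : Fin (m + 3) × Fin (m + 3),
      (c p * φ (y ∘ skip2 p.1 p.2)) • (br (R (x p.1)) (x p.2) + br (x p.1) (R (x p.2))) =
      ∑ i : Fin (m + 3),
        ((if p.2 = i then (c p * φ (y ∘ skip2 p.1 p.2)) • br (R (x p.1)) (x p.2) else 0) +
        (if p.1 = i then (c p * φ (y ∘ skip2 p.1 p.2)) • br (x p.1) (R (x p.2)) else 0)) := by
    intro p
    simp [Finset.sum_add_distrib]
  rw [Finset.sum_congr rfl fun p _ => hsplit p, Finset.sum_comm, ← Finset.sum_add_distrib]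
  refine Finset.sum_congr rfl fun i _ => ?_
  rw [← Finset.filter_filter, Finset.sum_filter (s := Finset.filter _ _),
    ← Finset.sum_add_distrib, phiBr]
  refine Finset.sum_congr rfl fun p hp => ?_
  have hlt : p.1 < p.2 := (Finset.mem_filter.mp hp).2
  by_cases h1 : p.1 = i
  · have h2 : p.2 ≠ i := fun h => hlt.ne (h1.trans h.symm)
    rw [update_comp_skip2 hlt (Or.inl h1.symm)]
    subst h1
    simp [h2, hc, hy]
  · by_cases h2 : p.2 = i
    · rw [update_comp_skip2 hlt (Or.inr h2.symm)]
      subst h2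
      simp [h1, hc, hy]
    · have hup : Function.update y i (x i) = fun j => if j = i then x j else R (x j) := by
        funext j
        by_cases hj : j = i
        · subst hj; simp
        · simp [hj, hy]
      simp [h1, h2, hup]
      rfl

theorem stmt12 (m : ℕ) (gr : ZMod 2 → Submodule K V) (br : V →ₗ[K] V →ₗ[K] V)
    (α : Module.End K V) (hg : IsHomLieSuper gr br α)
    (hmult : ∀ u v : V, α (br u v) = br (α u) (α v))
    (φ : MultilinearMap K (fun _ : Fin (m + 1) => V) K)
    (hφe : FormEven gr φ) (hφs : FormSuperSkew gr φ)
    (hc1 : PhiCond1 gr br φ) (hc2 : PhiCond2 φ α)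
    (R : Module.End K V) (hR : IsRotaBaxter2 gr br α R) :
    (∀ (d : Fin (m + 3) → ZMod 2) (x : Fin (m + 3) → V), (∀ i, x i ∈ gr (d i)) →
        phiBr br φ d (fun i => R (x i)) =
          R (∑ i : Fin (m + 3), phiBr br φ d (Function.update (fun j => R (x j)) i (x i)))) ↔
    (∀ (d : Fin (m + 3) → ZMod 2) (x : Fin (m + 3) → V), (∀ i, x i ∈ gr (d i)) →
      R (∑ i : Fin (m + 3), ∑ q ∈ Finset.univ.filter
            (fun q : Fin (m + 3) × Fin (m + 3) => q.1 < q.2 ∧ q.1 ≠ i ∧ q.2 ≠ i),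
          ((-1 : K) ^ ((q.1 : ℕ) + (q.2 : ℕ) + 1) * sgn K (gamma d q.1 q.2)
            * φ ((fun j => if j = i then x j else R (x j)) ∘ skip2 q.1 q.2)) •
          br (R (x q.1)) (R (x q.2))) = 0) := by
  refine forall_congr' fun d => forall_congr' fun x => imp_congr_right fun _ => ?_
  rw [sum_phiBr_update, map_add]
  have hbr : phiBr br φ d (fun i => R (x i)) =
      R (∑ p ∈ Finset.univ.filter (fun p : Fin (m + 3) × Fin (m + 3) => p.1 < p.2),
        ((-1 : K) ^ ((p.1 : ℕ) + (p.2 : ℕ) + 1) * sgn K (gamma d p.1 p.2)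
          * φ ((fun j => R (x j)) ∘ skip2 p.1 p.2)) •
        (br (R (x p.1)) (x p.2) + br (x p.1) (R (x p.2)))) := by
    rw [map_sum, phiBr]
    exact Finset.sum_congr rfl fun p _ => by rw [map_smul, hR.2.2]
  rw [hbr]
  exact right_eq_add

end NHomSuper
end

section
/- Let (g,[·,·],α) be a multiplicative Hom-Lie superalgebra over a field K of characteristic zero, n ≥ 3, and let R be a Rota-Baxter operator of weight 0 on g (R even, R∘α = α∘R, [R(x),R(y)] = R([R(x),y] + [x,R(y)])). Then R is a Rota-Baxter operator of weight 0 on the induced n-ary Hom-Nambu superalgebra (g, [·,…,·]ₙ, α^{n−2}) with [x₁,…,xₙ]ₙ = [[…[[x₁,x₂],α(x₃)],…,],α^{n−2}(xₙ)]: [R(x₁),…,R(xₙ)]ₙ = R(Σ_{i=1}^{n} [R(x₁),…,R(x_{i−1}),xᵢ,R(x_{i+1}),…,R(xₙ)]ₙ) for all x₁,…,xₙ. -/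
namespace NHomSuper

variable {K : Type*} [Field K] [CharZero K]
variable {V : Type*} [AddCommGroup V] [Module K V]

theorem nBr_rotaBaxter (br : V →ₗ[K] V →ₗ[K] V) (α R : Module.End K V)
    (hc : Commute R α) (hR : ∀ x y : V, br (R x) (R y) = R (br (R x) y + br x (R y)))
    (p : ℕ) (x : Fin (p + 2) → V) :
    nBr br α p (fun i => R (x i)) =
      R (∑ i, nBr br α p (Function.update (fun j => R (x j)) i (x i))) := by
  induction p with
  | zero =>
    simp [nBr, hR, Fin.sum_univ_two, add_comm]
  | succ p ih =>
    have hα (v : V) : (α ^ (p + 1)) (R v) = R ((α ^ (p + 1)) v) :=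
      (LinearMap.congr_fun (hc.pow_right (p + 1)).eq v).symm
    have hinit : Fin.init (fun j => R (x j)) = fun j => R (Fin.init x j) := rfl
    have hcast (i : Fin (p + 2)) :
        nBr br α (p + 1) (Function.update (fun j => R (x j)) i.castSucc (x i.castSucc)) =
          br (nBr br α p (Function.update (fun j => R (Fin.init x j)) i (Fin.init x i)))
            (R ((α ^ (p + 1)) (x (Fin.last (p + 2))))) := by
      rw [nBr, Fin.init_update_castSucc, hinit,
        Function.update_of_ne (Fin.castSucc_lt_last i).ne', hα]
      rfl
    have hlast :
        nBr br α (p + 1)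
            (Function.update (fun j => R (x j)) (Fin.last (p + 2)) (x (Fin.last (p + 2)))) =
          br (nBr br α p (fun j => R (Fin.init x j)))
            ((α ^ (p + 1)) (x (Fin.last (p + 2)))) := by
      rw [nBr, Fin.init_update_last, hinit, Function.update_self]
    rw [Fin.sum_univ_castSucc, hlast, Finset.sum_congr rfl fun i _ => hcast i, nBr, hinit,
      hα, ih, hR, map_sum br, LinearMap.sum_apply, add_comm]

theorem stmt13 (m : ℕ) (gr : ZMod 2 → Submodule K V) (br : V →ₗ[K] V →ₗ[K] V)
    (α : Module.End K V) (hg : IsHomLieSuper gr br α)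
    (hmult : ∀ u v : V, α (br u v) = br (α u) (α v))
    (R : Module.End K V) (hR : IsRotaBaxter2 gr br α R) :
    R * α ^ (m + 1) = α ^ (m + 1) * R ∧
    ∀ x : Fin (m + 3) → V,
      nBr br α (m + 1) (fun i => R (x i)) =
        R (∑ i : Fin (m + 3),
            nBr br α (m + 1) (Function.update (fun j => R (x j)) i (x i))) := by
  have hc : Commute R α := hR.2.1
  exact ⟨(hc.pow_right (m + 1)).eq, nBr_rotaBaxter br α R hc hR.2.2 (m + 1)⟩

end NHomSuper
end

section
/- Let (A,{·,·,·},α) be a 3-Hom-pre-Lie superalgebra over a field K of characteristic zero. Then A equipped with the induced 3-supercommutator [x,y,z]_C = {x,y,z} + (−1)^{|x|(|y|+|z|)}{y,z,x} + (−1)^{|z|(|x|+|y|)}{z,x,y} and the linear map α is a 3-Hom-Lie superalgebra: [·,·,·]_C is super-skew-symmetric and satisfies the identity [α(x₁),α(x₂),[x₃,x₄,x₅]_C]_C = [[x₁,x₂,x₃]_C,α(x₄),α(x₅)]_C + (−1)^{|x₃|(|x₁|+|x₂|)}[α(x₃),[x₁,x₂,x₄]_C,α(x₅)]_C + (−1)^{(|x₁|+|x₂|)(|x₃|+|x₄|)}[α(x₃),α(x₄),[x₁,x₂,x₅]_C]_C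 for all homogeneous x₁,…,x₅. -/
namespace NHomSuper

variable {K : Type*} [Field K] [CharZero K]
variable {V : Type*} [AddCommGroup V] [Module K V]

lemma sgn_add {K : Type*} [Field K] (a b : ZMod 2) : sgn K (a + b) = sgn K a * sgn K b := by
  rw [sgn, sgn, sgn, ← pow_add, ZMod.val_add, ← neg_one_pow_eq_pow_mod_two]

lemma sgn_mul_self {K : Type*} [Field K] (a : ZMod 2) : sgn K a * sgn K a = 1 := by
  rw [sgn, ← mul_pow, neg_mul_neg, one_mul, one_pow]

lemma cbr_mem {K V : Type*} [Field K] [AddCommGroup V] [Module K V]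
    {gr : ZMod 2 → Submodule K V} {T : V →ₗ[K] V →ₗ[K] V →ₗ[K] V} {α : Module.End K V}
    (h : Is3HomPreLieSuper gr T α) {a b c : ZMod 2} {x y z : V}
    (hx : x ∈ gr a) (hy : y ∈ gr b) (hz : z ∈ gr c) :
    cbr (K := K) (fun u v w => T u v w) a b c x y z ∈ gr (a + b + c) := by
  refine add_mem (add_mem (h.even a b c x y z hx hy hz) (Submodule.smul_mem _ _ ?_))
    (Submodule.smul_mem _ _ ?_)
  · simpa only [show b + c + a = a + b + c by ring] using h.even b c a y z x hy hz hx
  · simpa only [show c + a + b = a + b + c by ring] using h.even c a b z x y hz hx hy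

theorem stmt14 (gr : ZMod 2 → Submodule K V) (T : V →ₗ[K] V →ₗ[K] V →ₗ[K] V)
    (α : Module.End K V) (h : Is3HomPreLieSuper gr T α) :
    (∀ (a b c : ZMod 2) (x y z : V), x ∈ gr a → y ∈ gr b → z ∈ gr c →
      cbr (K := K) (fun u v w => T u v w) a b c x y z ∈ gr (a + b + c)) ∧
    (∀ (a b c : ZMod 2) (x y z : V), x ∈ gr a → y ∈ gr b → z ∈ gr c →
      cbr (K := K) (fun u v w => T u v w) a b c x y z =
        - sgn K (a * b) • cbr (K := K) (fun u v w => T u v w) b a c y x z) ∧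
    (∀ (a b c : ZMod 2) (x y z : V), x ∈ gr a → y ∈ gr b → z ∈ gr c →
      cbr (K := K) (fun u v w => T u v w) a b c x y z =
        - sgn K (b * c) • cbr (K := K) (fun u v w => T u v w) a c b x z y) ∧
    (∀ (a₁ a₂ a₃ a₄ a₅ : ZMod 2) (x₁ x₂ x₃ x₄ x₅ : V),
      x₁ ∈ gr a₁ → x₂ ∈ gr a₂ → x₃ ∈ gr a₃ → x₄ ∈ gr a₄ → x₅ ∈ gr a₅ →
      cbr (K := K) (fun u v w => T u v w) a₁ a₂ (a₃ + a₄ + a₅) (α x₁) (α x₂)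
          (cbr (K := K) (fun u v w => T u v w) a₃ a₄ a₅ x₃ x₄ x₅) =
        cbr (K := K) (fun u v w => T u v w) (a₁ + a₂ + a₃) a₄ a₅
            (cbr (K := K) (fun u v w => T u v w) a₁ a₂ a₃ x₁ x₂ x₃) (α x₄) (α x₅)
        + sgn K (a₃ * (a₁ + a₂)) •
            cbr (K := K) (fun u v w => T u v w) a₃ (a₁ + a₂ + a₄) a₅ (α x₃)
              (cbr (K := K) (fun u v w => T u v w) a₁ a₂ a₄ x₁ x₂ x₄) (α x₅)
        + sgn K ((a₁ + a₂) * (a₃ + a₄)) •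
            cbr (K := K) (fun u v w => T u v w) a₃ a₄ (a₁ + a₂ + a₅) (α x₃) (α x₄)
              (cbr (K := K) (fun u v w => T u v w) a₁ a₂ a₅ x₁ x₂ x₅)) := by
  refine ⟨fun a b c x y z hx hy hz => cbr_mem h hx hy hz, ?_, ?_, ?_⟩
  · intro a b c x y z hx hy hz
    have h1 := h.skew12 a b c x y z hx hy hz
    have h2 := h.skew12 b c a y z x hy hz hx
    have h3 := h.skew12 c a b z x y hz hx hy
    simp only [cbr, mul_add, sgn_add, mul_comm b a, mul_comm c a, mul_comm c b] at *
    have e1 := sgn_mul_self (K := K) (a * b)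
    have e2 := sgn_mul_self (K := K) (a * c)
    have e3 := sgn_mul_self (K := K) (b * c)
    rw [h1, h2, h3]
    match_scalars <;> grind
  · intro a b c x y z hx hy hz
    have h1 := h.skew12 a b c x y z hx hy hz
    have h2 := h.skew12 b c a y z x hy hz hx
    have h3 := h.skew12 c a b z x y hz hx hy
    simp only [cbr, mul_add, sgn_add, mul_comm b a, mul_comm c a, mul_comm c b] at *
    have e1 := sgn_mul_self (K := K) (a * b)
    have e2 := sgn_mul_self (K := K) (a * c)
    have e3 := sgn_mul_self (K := K) (b * c)
    rw [h1, h2, h3]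
    match_scalars <;> grind
  · intro a₁ a₂ a₃ a₄ a₅ x₁ x₂ x₃ x₄ x₅ hx₁ hx₂ hx₃ hx₄ hx₅
    have p₁ := h.ax2 a₁ a₂ a₃ a₄ a₅ x₁ x₂ x₃ x₄ x₅ hx₁ hx₂ hx₃ hx₄ hx₅
    have p₂ := h.ax2 a₁ a₂ a₄ a₅ a₃ x₁ x₂ x₄ x₅ x₃ hx₁ hx₂ hx₄ hx₅ hx₃
    have p₃ := h.ax2 a₁ a₂ a₅ a₃ a₄ x₁ x₂ x₅ x₃ x₄ hx₁ hx₂ hx₅ hx₃ hx₄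
    have q₁ := h.ax3 a₃ a₄ a₅ a₁ a₂ x₃ x₄ x₅ x₁ x₂ hx₃ hx₄ hx₅ hx₁ hx₂
    have q₂ := h.ax3 a₃ a₄ a₅ a₂ a₁ x₃ x₄ x₅ x₂ x₁ hx₃ hx₄ hx₅ hx₂ hx₁
    have hC : cbr (K := K) (fun u v w => T u v w) a₃ a₄ a₅ x₃ x₄ x₅ ∈ gr (a₃ + a₄ + a₅) :=
      cbr_mem h hx₃ hx₄ hx₅
    have r := h.skew12 a₂ (a₃ + a₄ + a₅) a₁ (α x₂) _ (α x₁)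
      (h.alpha_even _ _ hx₂) hC (h.alpha_even _ _ hx₁)
    have t₃ := h.skew12 a₃ a₂ a₁ x₃ x₂ x₁ hx₃ hx₂ hx₁
    have t₄ := h.skew12 a₄ a₂ a₁ x₄ x₂ x₁ hx₄ hx₂ hx₁
    have t₅ := h.skew12 a₅ a₂ a₁ x₅ x₂ x₁ hx₅ hx₂ hx₁
    rw [t₃, t₄, t₅] at q₂
    simp only [cbr, mul_add, add_mul, sgn_add, map_add, map_smul, LinearMap.add_apply,
      LinearMap.smul_apply, mul_comm a₃ a₁, mul_comm a₄ a₁, mul_comm a₅ a₁, mul_comm a₃ a₂,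
      mul_comm a₄ a₂, mul_comm a₅ a₂, mul_comm a₅ a₃, mul_comm a₅ a₄] at p₁ p₂ p₃ q₁ q₂ r ⊢
    have e12 := sgn_mul_self (K := K) (a₁ * a₂)
    have e13 := sgn_mul_self (K := K) (a₁ * a₃)
    have e14 := sgn_mul_self (K := K) (a₁ * a₄)
    have e15 := sgn_mul_self (K := K) (a₁ * a₅)
    have e23 := sgn_mul_self (K := K) (a₂ * a₃)
    have e24 := sgn_mul_self (K := K) (a₂ * a₄)
    have e25 := sgn_mul_self (K := K) (a₂ * a₅)
    have e34 := sgn_mul_self (K := K) (a₃ * a₄)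
    have e35 := sgn_mul_self (K := K) (a₃ * a₅)
    have e45 := sgn_mul_self (K := K) (a₄ * a₅)
    generalize sgn K (a₁ * a₂) = s12 at *
    generalize sgn K (a₁ * a₃) = s13 at *
    generalize sgn K (a₁ * a₄) = s14 at *
    generalize sgn K (a₁ * a₅) = s15 at *
    generalize sgn K (a₂ * a₃) = s23 at *
    generalize sgn K (a₂ * a₄) = s24 at *
    generalize sgn K (a₂ * a₅) = s25 at *
    generalize sgn K (a₃ * a₄) = s34 at *
    generalize sgn K (a₃ * a₅) = s35 at *
    generalize sgn K (a₄ * a₅) = s45 at *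
    linear_combination (norm := skip) p₁ + (s34 * s35) • p₂ + (s35 * s45) • p₃
      + (s13 * s14 * s15 * s23 * s24 * s25) • q₁
      - (s12 * s13 * s14 * s15 * s23 * s24 * s25) • q₂
      + (s12 * s13 * s14 * s15) • r
    clear p₁ p₂ p₃ q₁ q₂ r h hC t₃ t₄ t₅
    match_scalars <;> grind

end NHomSuper
end

section
/- Let (A,[·,·,·],α) be a 3-Hom-Lie superalgebra over a field K of characteristic zero and let R : A → A be a Rota-Baxter operator of weight 0 on A (R even, R∘α = α∘R, and [R(x),R(y),R(z)] = R([R(x),R(y),z] + [R(x),y,R(z)] + [x,R(y),R(z)]) for all x,y,z). Then the trilinear map {x,y,z} := [R(x),R(y),z], together with α, defines a 3-Hom-pre-Lie superalgebra structure on A. -/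
namespace NHomSuper

variable {K : Type*} [Field K] [CharZero K]
variable {V : Type*} [AddCommGroup V] [Module K V]

theorem sgn_smul_sgn_smul (a b : ZMod 2) (v : V) :
    sgn K a • sgn K b • v = sgn K (a + b) • v := by
  rw [smul_smul, sgn, sgn, sgn, ZMod.val_add, ← neg_one_pow_eq_pow_mod_two, pow_add]

namespace Is3HomLieSuper

variable {gr : ZMod 2 → Submodule K V} {br : V →ₗ[K] V →ₗ[K] V →ₗ[K] V} {α : Module.End K V}

theorem rotate_left (h : Is3HomLieSuper gr br α) {a b c : ZMod 2} {x y z : V}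
    (hx : x ∈ gr a) (hy : y ∈ gr b) (hz : z ∈ gr c) :
    br x y z = sgn K (a * (b + c)) • br y z x := by
  rw [h.skew12 a b c x y z hx hy hz, h.skew23 b a c y x z hy hx hz]
  simp only [neg_smul, smul_neg, neg_neg, sgn_smul_sgn_smul, mul_add]

theorem rotate_right (h : Is3HomLieSuper gr br α) {a b c : ZMod 2} {x y z : V}
    (hx : x ∈ gr a) (hy : y ∈ gr b) (hz : z ∈ gr c) :
    br x y z = sgn K (c * (a + b)) • br z x y := by
  rw [h.skew23 a b c x y z hx hy hz, h.skew12 a c b x z y hx hz hy]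
  simp only [neg_smul, smul_neg, neg_neg, sgn_smul_sgn_smul]
  congr 2
  ring

/-- The Hom-Nambu identity with the iterated bracket in the first slot. -/
theorem bracket_bracket_left (h : Is3HomLieSuper gr br α) {a₁ a₂ a₃ a₄ a₅ : ZMod 2}
    {x₁ x₂ x₃ x₄ x₅ : V} (h₁ : x₁ ∈ gr a₁) (h₂ : x₂ ∈ gr a₂) (h₃ : x₃ ∈ gr a₃)
    (h₄ : x₄ ∈ gr a₄) (h₅ : x₅ ∈ gr a₅) :
    br (br x₁ x₂ x₃) (α x₄) (α x₅) =
      br (α x₁) (α x₂) (br x₃ x₄ x₅)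
      + sgn K (a₁ * (a₂ + a₃)) • br (α x₂) (α x₃) (br x₁ x₄ x₅)
      + sgn K (a₃ * (a₁ + a₂)) • br (α x₃) (α x₁) (br x₂ x₄ x₅) := by
  have hα := h.alpha_even
  rw [h.rotate_left (h.even _ _ _ _ _ _ h₁ h₂ h₃) (hα _ _ h₄) (hα _ _ h₅),
    h.nambu _ _ _ _ _ _ _ _ _ _ h₄ h₅ h₁ h₂ h₃,
    h.rotate_left (h.even _ _ _ _ _ _ h₄ h₅ h₁) (hα _ _ h₂) (hα _ _ h₃),
    h.rotate_right (hα _ _ h₁) (h.even _ _ _ _ _ _ h₄ h₅ h₂) (hα _ _ h₃),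
    h.rotate_right h₄ h₅ h₁, h.rotate_right h₄ h₅ h₂, h.rotate_right h₄ h₅ h₃]
  have key : ∀ {a b : ZMod 2} (v : V), a = b → sgn K a • v = sgn K b • v := by
    rintro a _ v rfl
    rfl
  have one (v : V) : v = sgn K 0 • v := by simp [sgn]
  simp only [map_smul, smul_add, sgn_smul_sgn_smul]
  refine (add_comm _ _).trans (Eq.trans ?_ (add_assoc _ _ _).symm)
  refine congrArg₂ _ ((key _ ?_).trans (one _).symm)
    (congrArg₂ _ (key _ ?_) (key _ ?_)) <;>
  · clear * -
    revert a₁ a₂ a₃ a₄ a₅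
    decide

end Is3HomLieSuper

/-- A Rota-Baxter operator sends the supercommutator of `[R x, R y, z]` to `[R x, R y, R z]`. -/
theorem IsRotaBaxter3.map_cbr {gr : ZMod 2 → Submodule K V}
    {br : V →ₗ[K] V →ₗ[K] V →ₗ[K] V} {α R : Module.End K V}
    (hR : IsRotaBaxter3 gr br α R) (h : Is3HomLieSuper gr br α) {a b c : ZMod 2} {x y z : V}
    (hx : x ∈ gr a) (hy : y ∈ gr b) (hz : z ∈ gr c) :
    R (cbr (K := K) (fun u v w => br (R u) (R v) w) a b c x y z) = br (R x) (R y) (R z) := by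
  obtain ⟨hR₀, -, hR₂⟩ := hR
  rw [hR₂, cbr, ← h.rotate_left hx (hR₀ _ _ hy) (hR₀ _ _ hz),
    ← h.rotate_right (hR₀ _ _ hx) hy (hR₀ _ _ hz), add_right_comm]

theorem stmt16 (gr : ZMod 2 → Submodule K V) (br : V →ₗ[K] V →ₗ[K] V →ₗ[K] V)
    (α : Module.End K V) (h : Is3HomLieSuper gr br α)
    (R : Module.End K V) (hR : IsRotaBaxter3 gr br α R) :
    Is3HomPreLieSuper gr ((br.comp (R : V →ₗ[K] V)).compl₂ (R : V →ₗ[K] V)) α := by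
  have hc (a b c : ZMod 2) (x y z : V) (hx : x ∈ gr a) (hy : y ∈ gr b) (hz : z ∈ gr c) :=
    hR.map_cbr h hx hy hz
  obtain ⟨hR₀, hR₁, -⟩ := hR
  have hRα (x : V) : R (α x) = α (R x) := LinearMap.congr_fun hR₁ x
  refine ⟨h.internal, h.alpha_even, ?_, ?_, ?_, ?_⟩
  · intro a b c x y z hx hy hz
    exact h.even _ _ _ _ _ _ (hR₀ _ _ hx) (hR₀ _ _ hy) hz
  · intro a b c x y z hx hy hz
    exact h.skew12 _ _ _ _ _ _ (hR₀ _ _ hx) (hR₀ _ _ hy) hz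
  · intro a₁ a₂ a₃ a₄ a₅ x₁ x₂ x₃ x₄ x₅ h₁ h₂ h₃ h₄ h₅
    simp only [LinearMap.compl₂_apply, LinearMap.comp_apply, hRα,
      hc _ _ _ _ _ _ h₁ h₂ h₃, hc _ _ _ _ _ _ h₁ h₂ h₄]
    rw [mul_comm a₃]
    exact h.nambu _ _ _ _ _ _ _ _ _ _ (hR₀ _ _ h₁) (hR₀ _ _ h₂) (hR₀ _ _ h₃) (hR₀ _ _ h₄) h₅
  · intro a₁ a₂ a₃ a₄ a₅ x₁ x₂ x₃ x₄ x₅ h₁ h₂ h₃ h₄ h₅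
    simp only [LinearMap.compl₂_apply, LinearMap.comp_apply, hRα, hc _ _ _ _ _ _ h₁ h₂ h₃]
    exact h.bracket_bracket_left (hR₀ _ _ h₁) (hR₀ _ _ h₂) (hR₀ _ _ h₃) (hR₀ _ _ h₄) h₅

end NHomSuper
end
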